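/- arXiv:2203.01028 — 6 statements merged into one kernel-verified Lean document; each statement's English description precedes it below -/
import Mathlib

section
/- Let (Ω, 𝒜, μ) be a measure space, let m ≥ 1 be an integer, let L ∈ ℕ, and let g_0, g_1, …, g_{L+1} : Ω → [0, ∞) be measurable functions with g_{j+1} ≤ g_j μ-almost everywhere on Ω for each 0 ≤ j ≤ L. Suppose E_0, …, E_L ∈ 𝒜 are measurable sets such that g_{j+1} ≤ 2^{−1/3}·g_j holds μ-almost everywhere on E_j for each 0 ≤ j ≤ L. Then for every measurable f : Ω → ℝ, ((4^{m/3} − 1)/4^{m/3})·Σ_{j=0}^{L} ∫_{E_j} g_j^{2m}·f² dμ ≤ ∫_Ω g_0^{2m}·f² dμ, all integrals being taken as (possibly infinite) integrals of nonnegative measurable functions. -/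
open MeasureTheory

/-- If `b ≤ a` almost everywhere and `b ≤ (1 - c) a` almost everywhere on `E`, then the integral
drops from `a` to `b` by at least `c` times the integral of `a` over `E`. -/
theorem mul_setLIntegral_add_lintegral_le {Ω : Type*} [MeasurableSpace Ω] {μ : Measure Ω}
    {a b : Ω → ℝ} {E : Set Ω} {c : ℝ} (hc : 0 ≤ c) (hE : MeasurableSet E)
    (ha_meas : Measurable a) (hb : ∀ x, 0 ≤ b x) (ha : ∀ x, 0 ≤ a x)
    (hba : ∀ᵐ x ∂μ, b x ≤ a x) (hbE : ∀ᵐ x ∂μ, x ∈ E → b x ≤ (1 - c) * a x) :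
    ENNReal.ofReal c * ∫⁻ x in E, ENNReal.ofReal (a x) ∂μ + ∫⁻ x, ENNReal.ofReal (b x) ∂μ
      ≤ ∫⁻ x, ENNReal.ofReal (a x) ∂μ := by
  rw [← lintegral_const_mul' _ _ ENNReal.ofReal_ne_top, ← lintegral_indicator hE,
    ← lintegral_add_left ((ha_meas.ennreal_ofReal.const_mul _).indicator hE)]
  refine lintegral_mono_ae ?_
  filter_upwards [hba, hbE] with x hx hxE
  by_cases hmem : x ∈ E
  · rw [Set.indicator_of_mem hmem, ← ENNReal.ofReal_mul hc,
      ← ENNReal.ofReal_add (mul_nonneg hc (ha x)) (hb x)]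
    exact ENNReal.ofReal_le_ofReal (by linarith [hxE hmem])
  · rw [Set.indicator_of_notMem hmem, zero_add]
    exact ENNReal.ofReal_le_ofReal hx

/-- Telescoping: if `c * I j + A (j + 1) ≤ A j` for all `j < n`, then
`c * ∑ j < n, I j + A n ≤ A 0`. -/
theorem mul_sum_range_add_le (c : ENNReal) (I A : ℕ → ENNReal) (n : ℕ)
    (h : ∀ j < n, c * I j + A (j + 1) ≤ A j) :
    c * ∑ j ∈ Finset.range n, I j + A n ≤ A 0 := by
  induction n with
  | zero => simp
  | succ n ih =>
    rw [Finset.sum_range_succ, mul_add, add_assoc]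
    exact (add_le_add_right (h n n.lt_succ_self) _).trans
      (ih fun j hj => h j (hj.trans n.lt_succ_self))

theorem two_rpow_neg_third_pow (m : ℕ) :
    ((2 : ℝ) ^ (-(1/3) : ℝ)) ^ (2 * m) = ((4 : ℝ) ^ ((m : ℝ) / 3))⁻¹ := by
  rw [← Real.rpow_natCast, ← Real.rpow_mul (by norm_num), ← Real.rpow_neg (by norm_num),
    show (4 : ℝ) = 2 ^ (2 : ℝ) by norm_num, ← Real.rpow_mul (by norm_num)]
  congr 1
  push_cast
  ring

/-- Mesh-size accumulation estimate: if `g_{j+1} ≤ g_j` a.e. on `Ω` and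
`g_{j+1} ≤ 2^{−1/3}·g_j` a.e. on measurable sets `E_j` (for `0 ≤ j ≤ L`), then for every
measurable `f`, `((4^{m/3}−1)/4^{m/3})·Σ_{j=0}^{L} ∫_{E_j} g_j^{2m} f² dμ ≤ ∫_Ω g_0^{2m} f² dμ`. -/
theorem stmt4 {Ω : Type*} [MeasurableSpace Ω] (μ : Measure Ω)
    (m : ℕ) (hm : 1 ≤ m) (L : ℕ)
    (g : ℕ → Ω → ℝ)
    (hg_meas : ∀ j, j ≤ L + 1 → Measurable (g j))
    (hg_nonneg : ∀ j, j ≤ L + 1 → ∀ x, 0 ≤ g j x)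
    (hg_mono : ∀ j, j ≤ L → ∀ᵐ x ∂μ, g (j + 1) x ≤ g j x)
    (E : ℕ → Set Ω) (hE : ∀ j, j ≤ L → MeasurableSet (E j))
    (hred : ∀ j, j ≤ L →
      ∀ᵐ x ∂(μ.restrict (E j)), g (j + 1) x ≤ (2 : ℝ) ^ (-(1/3) : ℝ) * g j x)
    (f : Ω → ℝ) (hf : Measurable f) :
    ENNReal.ofReal (((4 : ℝ) ^ ((m : ℝ) / 3) - 1) / (4 : ℝ) ^ ((m : ℝ) / 3)) *
        ∑ j ∈ Finset.range (L + 1),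
          ∫⁻ x in E j, ENNReal.ofReal ((g j x) ^ (2 * m) * (f x) ^ 2) ∂μ
      ≤ ∫⁻ x, ENNReal.ofReal ((g 0 x) ^ (2 * m) * (f x) ^ 2) ∂μ := by
  have hq : (1 : ℝ) ≤ (4 : ℝ) ^ ((m : ℝ) / 3) :=
    Real.one_le_rpow (by norm_num) (by positivity)
  have hpow := two_rpow_neg_third_pow m
  set q : ℝ := (4 : ℝ) ^ ((m : ℝ) / 3)
  have hq0 : 0 < q := by linarith
  have hc : 1 - (q - 1) / q = q⁻¹ := by field_simp; ring
  refine le_self_add.trans (mul_sum_range_add_le _ _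
    (fun j => ∫⁻ x, ENNReal.ofReal ((g j x) ^ (2 * m) * (f x) ^ 2) ∂μ) (L + 1) fun j hj => ?_)
  have hjL : j ≤ L := Nat.lt_succ_iff.mp hj
  have hg0 := hg_nonneg j (by omega)
  have hg1 := hg_nonneg (j + 1) (by omega)
  refine mul_setLIntegral_add_lintegral_le (div_nonneg (by linarith) hq0.le) (hE j hjL)
    (((hg_meas j (by omega)).pow_const _).mul (hf.pow_const _))
    (fun x => mul_nonneg (pow_nonneg (hg1 x) _) (sq_nonneg _))
    (fun x => mul_nonneg (pow_nonneg (hg0 x) _) (sq_nonneg _)) ?_ ?_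
  · filter_upwards [hg_mono j hjL] with x hx
    exact mul_le_mul_of_nonneg_right (pow_le_pow_left₀ (hg1 x) hx _) (sq_nonneg _)
  · filter_upwards [(ae_restrict_iff' (hE j hjL)).mp (hred j hjL)] with x hx hxE
    rw [hc, ← hpow, ← mul_assoc, ← mul_pow]
    exact mul_le_mul_of_nonneg_right (pow_le_pow_left₀ (hg1 x) (hx hxE) _) (sq_nonneg _)
end

section
/- Let ρ, Λ, Λ₄, ε₄ be nonnegative real numbers with ρ + ε₄·Λ < 1, and let (η_j)_{j∈ℕ} and (δ_j)_{j∈ℕ} be sequences of nonnegative real numbers such that (i) η_{j+1}² ≤ ρ·η_j² + Λ·δ_j² for all j ∈ ℕ, and (ii) Σ_{j=ℓ}^{ℓ+m} δ_j² ≤ Λ₄·η_ℓ² + ε₄·Σ_{j=ℓ}^{ℓ+m} η_j² for all ℓ, m ∈ ℕ. Then, with Λ_qo := Λ₄ + ε₄·(1 + Λ·Λ₄)/(1 − ρ − ε₄·Λ), it holds Σ_{j=ℓ}^{ℓ+m} δ_j² ≤ Λ_qo·η_ℓ² for all ℓ, m ∈ ℕ. -/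
/-- Summing the contraction `a (j + 1) ≤ ρ * a j + Λ * b j` over `ℓ ≤ j ≤ ℓ + m`. -/
theorem sum_Icc_add_succ_le_of_contraction {a b : ℕ → ℝ} {ρ Λ : ℝ}
    (h : ∀ j, a (j + 1) ≤ ρ * a j + Λ * b j) (ℓ m : ℕ) :
    ∑ j ∈ Finset.Icc ℓ (ℓ + m), a j + a (ℓ + m + 1) ≤
      a ℓ + ρ * ∑ j ∈ Finset.Icc ℓ (ℓ + m), a j + Λ * ∑ j ∈ Finset.Icc ℓ (ℓ + m), b j := by
  induction m with
  | zero => simpa [add_assoc] using h ℓ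
  | succ m ih =>
    rw [← add_assoc, Finset.sum_Icc_succ_top (by lia), Finset.sum_Icc_succ_top (by lia)]
    linarith [h (ℓ + m + 1)]

/-- Stricter quasi-orthogonality from estimator reduction and
weak quasi-orthogonality (abstracted to real sequences). -/
theorem stmt5 (ρ Λ Λ₄ ε₄ : ℝ) (hρ : 0 ≤ ρ) (hΛ : 0 ≤ Λ) (hΛ₄ : 0 ≤ Λ₄) (hε₄ : 0 ≤ ε₄)
    (hsmall : ρ + ε₄ * Λ < 1)
    (η δ : ℕ → ℝ) (hη : ∀ j, 0 ≤ η j) (hδ : ∀ j, 0 ≤ δ j)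
    (h1 : ∀ j : ℕ, η (j + 1) ^ 2 ≤ ρ * η j ^ 2 + Λ * δ j ^ 2)
    (h2 : ∀ ℓ m : ℕ, ∑ j ∈ Finset.Icc ℓ (ℓ + m), δ j ^ 2 ≤
      Λ₄ * η ℓ ^ 2 + ε₄ * ∑ j ∈ Finset.Icc ℓ (ℓ + m), η j ^ 2) :
    ∀ ℓ m : ℕ, ∑ j ∈ Finset.Icc ℓ (ℓ + m), δ j ^ 2 ≤
      (Λ₄ + ε₄ * (1 + Λ * Λ₄) / (1 - ρ - ε₄ * Λ)) * η ℓ ^ 2 := by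
  intro ℓ m
  have hpos : 0 < 1 - ρ - ε₄ * Λ := by linarith
  have hred := sum_Icc_add_succ_le_of_contraction (a := fun j => η j ^ 2)
    (b := fun j => δ j ^ 2) h1 ℓ m
  have hqo := h2 ℓ m
  have hsum : ∑ j ∈ Finset.Icc ℓ (ℓ + m), η j ^ 2 ≤
      (1 + Λ * Λ₄) * η ℓ ^ 2 / (1 - ρ - ε₄ * Λ) := by
    rw [le_div_iff₀ hpos]
    linarith [mul_le_mul_of_nonneg_left hqo hΛ, sq_nonneg (η (ℓ + m + 1))]
  calc ∑ j ∈ Finset.Icc ℓ (ℓ + m), δ j ^ 2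
      ≤ Λ₄ * η ℓ ^ 2 + ε₄ * ∑ j ∈ Finset.Icc ℓ (ℓ + m), η j ^ 2 := hqo
    _ ≤ Λ₄ * η ℓ ^ 2 + ε₄ * ((1 + Λ * Λ₄) * η ℓ ^ 2 / (1 - ρ - ε₄ * Λ)) := by gcongr
    _ = (Λ₄ + ε₄ * (1 + Λ * Λ₄) / (1 - ρ - ε₄ * Λ)) * η ℓ ^ 2 := by ring
end

section
/- Let ρ, Λ, Λ_qo be nonnegative real numbers with ρ < 1, and let (η_j)_{j∈ℕ} and (δ_j)_{j∈ℕ} be sequences of nonnegative real numbers such that η_{j+1}² ≤ ρ·η_j² + Λ·δ_j² for all j ∈ ℕ and Σ_{k=ℓ}^{ℓ+m} δ_k² ≤ Λ_qo·η_ℓ² for all ℓ, m ∈ ℕ. Then, with Λ_c := (1 + Λ·Λ_qo)/(1 − ρ) and q_c := Λ_c/(1 + Λ_c), it holds Σ_{k=ℓ}^{ℓ+m} η_k² ≤ Λ_c·η_ℓ² and η_{ℓ+m}² ≤ (q_c^m/(1 − q_c))·η_ℓ² for all ℓ, m ∈ ℕ. -/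
theorem sum_Icc_add_eq_sum_range (f : ℕ → ℝ) (l m : ℕ) :
    ∑ k ∈ Finset.Icc l (l + m), f k = ∑ i ∈ Finset.range (m + 1), f (l + i) := by
  rw [← Finset.Ico_add_one_right_eq_Icc, Finset.sum_Ico_eq_sum_range]
  congr 2
  omega

/-- Telescoping of a perturbed contraction. -/
theorem one_sub_mul_sum_range_le {a d : ℕ → ℝ} {ρ Λ : ℝ}
    (h : ∀ j, a (j + 1) ≤ ρ * a j + Λ * d j) (l m : ℕ) :
    (1 - ρ) * ∑ i ∈ Finset.range (m + 1), a (l + i) ≤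
      a l - ρ * a (l + m) + Λ * ∑ i ∈ Finset.range m, d (l + i) := by
  induction m with
  | zero => simp; linarith
  | succ m ih =>
    rw [Finset.sum_range_succ, Finset.sum_range_succ (fun i => d (l + i)), mul_add, mul_add]
    have := h (l + m)
    rw [← add_assoc]
    linarith

/-- If all tail sums of a nonnegative sequence are controlled by their first term, then the
sequence decays geometrically relative to its partial sums. -/
theorem le_pow_mul_sum_range_of_sum_range_le {a : ℕ → ℝ} {C : ℝ} (ha : ∀ j, 0 ≤ a j)
    (hC : 0 ≤ C) (h : ∀ l m, ∑ i ∈ Finset.range (m + 1), a (l + i) ≤ C * a l) (l m : ℕ) :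
    a (l + m) ≤ (C / (1 + C)) ^ m * ∑ i ∈ Finset.range (m + 1), a (l + i) := by
  induction m generalizing l with
  | zero => simp
  | succ m ih =>
    have hsplit : ∑ i ∈ Finset.range (m + 1 + 1), a (l + i) =
        ∑ i ∈ Finset.range (m + 1), a (l + 1 + i) + a l := by
      rw [Finset.sum_range_succ']
      simp only [add_zero, add_assoc, add_comm 1]
    have htail : ∑ i ∈ Finset.range (m + 1), a (l + 1 + i) ≤
        C / (1 + C) * ∑ i ∈ Finset.range (m + 1 + 1), a (l + i) := by
      rw [div_mul_eq_mul_div, le_div_iff₀ (by linarith)]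
      have := h l (m + 1)
      rw [hsplit] at this ⊢
      linarith [ha l]
    calc a (l + (m + 1)) = a (l + 1 + m) := by rw [add_assoc, add_comm 1]
      _ ≤ (C / (1 + C)) ^ m * ∑ i ∈ Finset.range (m + 1), a (l + 1 + i) := ih (l + 1)
      _ ≤ (C / (1 + C)) ^ m *
          (C / (1 + C) * ∑ i ∈ Finset.range (m + 1 + 1), a (l + i)) := by gcongr
      _ = _ := by ring

/-- Plain and R-linear convergence of the estimator sequence
(abstracted to real sequences). -/
theorem stmt6 (ρ Λ Λqo : ℝ) (hρ0 : 0 ≤ ρ) (hρ1 : ρ < 1) (hΛ : 0 ≤ Λ) (hΛqo : 0 ≤ Λqo)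
    (η δ : ℕ → ℝ) (hη : ∀ j, 0 ≤ η j) (hδ : ∀ j, 0 ≤ δ j)
    (h1 : ∀ j : ℕ, η (j + 1) ^ 2 ≤ ρ * η j ^ 2 + Λ * δ j ^ 2)
    (h2 : ∀ ℓ m : ℕ, ∑ k ∈ Finset.Icc ℓ (ℓ + m), δ k ^ 2 ≤ Λqo * η ℓ ^ 2) :
    ∀ ℓ m : ℕ,
      (∑ k ∈ Finset.Icc ℓ (ℓ + m), η k ^ 2 ≤ (1 + Λ * Λqo) / (1 - ρ) * η ℓ ^ 2) ∧
      (η (ℓ + m) ^ 2 ≤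
        (((1 + Λ * Λqo) / (1 - ρ)) / (1 + (1 + Λ * Λqo) / (1 - ρ))) ^ m /
          (1 - ((1 + Λ * Λqo) / (1 - ρ)) / (1 + (1 + Λ * Λqo) / (1 - ρ))) * η ℓ ^ 2) := by
  have hpos : 0 < 1 - ρ := by linarith
  have hC : 0 ≤ (1 + Λ * Λqo) / (1 - ρ) := by positivity
  have hsum : ∀ l m, ∑ i ∈ Finset.range (m + 1), η (l + i) ^ 2 ≤
      (1 + Λ * Λqo) / (1 - ρ) * η l ^ 2 := by
    intro l m
    have htel := one_sub_mul_sum_range_le (a := fun j => η j ^ 2) (d := fun j => δ j ^ 2) h1 l m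
    have hqo := h2 l m
    rw [sum_Icc_add_eq_sum_range (fun k => δ k ^ 2), Finset.sum_range_succ] at hqo
    have hδsum : ∑ i ∈ Finset.range m, δ (l + i) ^ 2 ≤ Λqo * η l ^ 2 := by
      linarith [sq_nonneg (δ (l + m))]
    have hΛsum := mul_le_mul_of_nonneg_left hδsum hΛ
    have hlast : 0 ≤ ρ * η (l + m) ^ 2 := by positivity
    rw [div_mul_eq_mul_div, le_div_iff₀ hpos]
    linarith
  intro ℓ m
  refine ⟨(sum_Icc_add_eq_sum_range (fun k => η k ^ 2) ℓ m).trans_le (hsum ℓ m), ?_⟩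
  have hdecay := le_pow_mul_sum_range_of_sum_range_le (a := fun j => η j ^ 2)
    (fun j => sq_nonneg _) hC hsum ℓ m
  have hbound := hsum ℓ m
  generalize (1 + Λ * Λqo) / (1 - ρ) = C at *
  have hq : 1 - C / (1 + C) = (1 + C)⁻¹ := by
    field_simp
    ring
  rw [hq, div_inv_eq_mul, mul_assoc]
  refine hdecay.trans (mul_le_mul_of_nonneg_left ?_ (by positivity))
  exact hbound.trans (by nlinarith [sq_nonneg (η ℓ)])
end

section
/- Let Λ₁, Λ₂, ρ₂ be nonnegative real numbers, let 0 < θ ≤ 1, and let μ, ξ > 0 satisfy (1+μ)·ρ₂² ≤ 1+ξ. Let a, â, b, b̂, δ, η, η̂ be nonnegative real numbers with η² = a² + b², η̂² = â² + b̂², |a − â| ≤ Λ₁·δ, b̂ ≤ ρ₂·b + Λ₂·δ, and θ·η² ≤ b². Then η̂² ≤ ((1−θ)·(1+ξ) + θ·(1+μ)·ρ₂²)·η² + ((1+1/ξ)·Λ₁² + (1+1/μ)·Λ₂²)·δ². -/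
/-- Young's inequality for the square of a sum, with weight `t`. -/
theorem add_sq_le_weighted {t : ℝ} (ht : 0 < t) (x y : ℝ) :
    (x + y) ^ 2 ≤ (1 + t) * x ^ 2 + (1 + 1 / t) * y ^ 2 := by
  have h : (1 + t) * x ^ 2 + (1 + 1 / t) * y ^ 2 - (x + y) ^ 2 = (t * x - y) ^ 2 / t := by
    field_simp
    ring
  have : 0 ≤ (t * x - y) ^ 2 / t := by positivity
  linarith

/-- Estimator reduction (A12) from stability (A1), reduction (A2), and
Dörfler marking, abstracted to real numbers. -/
theorem stmt8 (Λ₁ Λ₂ ρ₂ : ℝ) (hΛ₁ : 0 ≤ Λ₁) (hΛ₂ : 0 ≤ Λ₂) (hρ₂ : 0 ≤ ρ₂)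
    (θ : ℝ) (hθ0 : 0 < θ) (hθ1 : θ ≤ 1)
    (μ ξ : ℝ) (hμ : 0 < μ) (hξ : 0 < ξ) (hμξ : (1 + μ) * ρ₂ ^ 2 ≤ 1 + ξ)
    (a ahat b bhat δ η ηhat : ℝ)
    (ha : 0 ≤ a) (hahat : 0 ≤ ahat) (hb : 0 ≤ b) (hbhat : 0 ≤ bhat)
    (hδ : 0 ≤ δ) (hη : 0 ≤ η) (hηhat : 0 ≤ ηhat)
    (hη2 : η ^ 2 = a ^ 2 + b ^ 2) (hηhat2 : ηhat ^ 2 = ahat ^ 2 + bhat ^ 2)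
    (hA1 : |a - ahat| ≤ Λ₁ * δ) (hA2 : bhat ≤ ρ₂ * b + Λ₂ * δ)
    (hmark : θ * η ^ 2 ≤ b ^ 2) :
    ηhat ^ 2 ≤ ((1 - θ) * (1 + ξ) + θ * (1 + μ) * ρ₂ ^ 2) * η ^ 2 +
      ((1 + 1 / ξ) * Λ₁ ^ 2 + (1 + 1 / μ) * Λ₂ ^ 2) * δ ^ 2 := by
  have hahat_le : ahat ≤ a + Λ₁ * δ := by linarith [(abs_le.mp hA1).1]
  have h1 := (pow_le_pow_left₀ hahat hahat_le 2).trans (add_sq_le_weighted hξ a (Λ₁ * δ))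
  have h2 := (pow_le_pow_left₀ hbhat hA2 2).trans (add_sq_le_weighted hμ (ρ₂ * b) (Λ₂ * δ))
  have h3 := mul_le_mul_of_nonneg_left hmark (sub_nonneg.mpr hμξ)
  have ha2 : a ^ 2 = η ^ 2 - b ^ 2 := by linarith
  rw [ha2] at h1
  rw [hηhat2]
  linarith
end

section
/- Let Λ₁, Λ₂, Λ₃, Λ̂₃, ε₃ be nonnegative real numbers, let 0 ≤ ρ₂ ≤ 1, and let α > 0 satisfy (1+α)·(Λ₁²+Λ₂²)·Λ̂₃ < 1. Let a, â, b, b̂, δ, η, η̂ be nonnegative real numbers with η̂² ≤ â² + b̂², â ≤ a + Λ₁·δ, b̂ ≤ ρ₂·b + Λ₂·δ, a² + b² ≤ η², and δ² ≤ (Λ₃ + ε₃)·η² + Λ̂₃·η̂². Then η̂² ≤ Λ_mon²·η², where Λ_mon² := (1 + 1/α + (1+α)·(Λ₁²+Λ₂²)·(Λ₃+ε₃))/(1 − (1+α)·(Λ₁²+Λ₂²)·Λ̂₃). -/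
/-- Young's inequality for the square of a sum, with weight `α`. -/
theorem add_sq_le_young {α : ℝ} (hα : 0 < α) (x y : ℝ) :
    (x + y) ^ 2 ≤ (1 + 1 / α) * x ^ 2 + (1 + α) * y ^ 2 := by
  have h : (1 + 1 / α) * x ^ 2 + (1 + α) * y ^ 2 - (x + y) ^ 2 = (x - α * y) ^ 2 / α := by
    field_simp
    ring
  have : 0 ≤ (x - α * y) ^ 2 / α := by positivity
  linarith

/-- Quasimonotonicity (QM) of the error estimator from the axioms
(A1), (A2), and (A3_ε), abstracted to real numbers. -/
theorem stmt9 (Λ₁ Λ₂ Λ₃ Λ₃hat ε₃ : ℝ)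
    (hΛ₁ : 0 ≤ Λ₁) (hΛ₂ : 0 ≤ Λ₂) (hΛ₃ : 0 ≤ Λ₃) (hΛ₃hat : 0 ≤ Λ₃hat) (hε₃ : 0 ≤ ε₃)
    (ρ₂ : ℝ) (hρ₂0 : 0 ≤ ρ₂) (hρ₂1 : ρ₂ ≤ 1)
    (α : ℝ) (hα : 0 < α) (hαsmall : (1 + α) * (Λ₁ ^ 2 + Λ₂ ^ 2) * Λ₃hat < 1)
    (a ahat b bhat δ η ηhat : ℝ)
    (ha : 0 ≤ a) (hahat : 0 ≤ ahat) (hb : 0 ≤ b) (hbhat : 0 ≤ bhat)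
    (hδ : 0 ≤ δ) (hη : 0 ≤ η) (hηhat : 0 ≤ ηhat)
    (hηhat2 : ηhat ^ 2 ≤ ahat ^ 2 + bhat ^ 2)
    (hA1 : ahat ≤ a + Λ₁ * δ) (hA2 : bhat ≤ ρ₂ * b + Λ₂ * δ)
    (hab : a ^ 2 + b ^ 2 ≤ η ^ 2)
    (hA3 : δ ^ 2 ≤ (Λ₃ + ε₃) * η ^ 2 + Λ₃hat * ηhat ^ 2) :
    ηhat ^ 2 ≤ ((1 + 1 / α + (1 + α) * (Λ₁ ^ 2 + Λ₂ ^ 2) * (Λ₃ + ε₃)) /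
      (1 - (1 + α) * (Λ₁ ^ 2 + Λ₂ ^ 2) * Λ₃hat)) * η ^ 2 := by
  have hbhat' : bhat ≤ b + Λ₂ * δ := by
    linarith [mul_le_of_le_one_left hb hρ₂1]
  have hasq : ahat ^ 2 ≤ (1 + 1 / α) * a ^ 2 + (1 + α) * (Λ₁ * δ) ^ 2 :=
    (pow_le_pow_left₀ hahat hA1 2).trans (add_sq_le_young hα _ _)
  have hbsq : bhat ^ 2 ≤ (1 + 1 / α) * b ^ 2 + (1 + α) * (Λ₂ * δ) ^ 2 :=
    (pow_le_pow_left₀ hbhat hbhat' 2).trans (add_sq_le_young hα _ _)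
  have hunperturbed : (1 + 1 / α) * (a ^ 2 + b ^ 2) ≤ (1 + 1 / α) * η ^ 2 :=
    mul_le_mul_of_nonneg_left hab (by positivity)
  have hperturbation : (1 + α) * (Λ₁ ^ 2 + Λ₂ ^ 2) * δ ^ 2 ≤
      (1 + α) * (Λ₁ ^ 2 + Λ₂ ^ 2) * ((Λ₃ + ε₃) * η ^ 2 + Λ₃hat * ηhat ^ 2) :=
    mul_le_mul_of_nonneg_left hA3 (by positivity)
  rw [div_mul_eq_mul_div, le_div_iff₀ (by linarith)]
  linarith
end

section
/- Let Λ₁, Λ₃, Λ̂₃, ε₃ be nonnegative real numbers, let 0 < κ < 1 and α > 0, and let a, δ, η, η_R, η̂ be nonnegative real numbers with η̂ ≤ κ·η, a ≤ η̂ + Λ₁·δ, η² ≤ η_R² + a², and δ² ≤ Λ₃·η_R² + Λ̂₃·η̂² + ε₃·η². Then θ₀·η² ≤ η_R², where θ₀ := (1 − κ²·((1+α) + (1+1/α)·Λ₁²·Λ̂₃) − (1+1/α)·Λ₁²·ε₃)/(1 + (1+1/α)·Λ₁²·Λ₃). -/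
/-- Young's inequality for the square of a sum, with parameter `α`. -/
theorem add_sq_le_one_add_mul_sq {α : ℝ} (hα : 0 < α) (x y : ℝ) :
    (x + y) ^ 2 ≤ (1 + α) * x ^ 2 + (1 + 1 / α) * y ^ 2 := by
  have h : (1 + α) * x ^ 2 + (1 + 1 / α) * y ^ 2 - (x + y) ^ 2 = (α * x - y) ^ 2 / α := by
    field_simp
    ring
  have : 0 ≤ (α * x - y) ^ 2 / α := by positivity
  linarith

/-- Comparison lemma, part (c): the refined set satisfies the Dörfler
marking property with bulk parameter `θ₀ = θ₀(α, κ)`, abstracted to real numbers. -/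
theorem stmt10 (Λ₁ Λ₃ Λ₃hat ε₃ : ℝ)
    (hΛ₁ : 0 ≤ Λ₁) (hΛ₃ : 0 ≤ Λ₃) (hΛ₃hat : 0 ≤ Λ₃hat) (hε₃ : 0 ≤ ε₃)
    (κ α : ℝ) (hκ0 : 0 < κ) (hκ1 : κ < 1) (hα : 0 < α)
    (a δ η ηR ηhat : ℝ)
    (ha : 0 ≤ a) (hδ : 0 ≤ δ) (hη : 0 ≤ η) (hηR : 0 ≤ ηR) (hηhat : 0 ≤ ηhat)
    (h1 : ηhat ≤ κ * η)
    (h2 : a ≤ ηhat + Λ₁ * δ)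
    (h3 : η ^ 2 ≤ ηR ^ 2 + a ^ 2)
    (h4 : δ ^ 2 ≤ Λ₃ * ηR ^ 2 + Λ₃hat * ηhat ^ 2 + ε₃ * η ^ 2) :
    ((1 - κ ^ 2 * ((1 + α) + (1 + 1 / α) * Λ₁ ^ 2 * Λ₃hat) - (1 + 1 / α) * Λ₁ ^ 2 * ε₃) /
        (1 + (1 + 1 / α) * Λ₁ ^ 2 * Λ₃)) * η ^ 2 ≤ ηR ^ 2 := by
  have hc : 0 ≤ (1 + 1 / α) * Λ₁ ^ 2 := by positivity
  have ha_sq : a ^ 2 ≤ (1 + α) * ηhat ^ 2 + (1 + 1 / α) * Λ₁ ^ 2 * δ ^ 2 :=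
    calc a ^ 2 ≤ (ηhat + Λ₁ * δ) ^ 2 := by gcongr
      _ ≤ (1 + α) * ηhat ^ 2 + (1 + 1 / α) * (Λ₁ * δ) ^ 2 := add_sq_le_one_add_mul_sq hα _ _
      _ = _ := by ring
  generalize (1 + 1 / α) * Λ₁ ^ 2 = c at hc ha_sq ⊢
  have hηhat_sq : ηhat ^ 2 ≤ κ ^ 2 * η ^ 2 := by
    rw [← mul_pow]
    gcongr
  have hδ_sq := mul_le_mul_of_nonneg_left h4 hc
  have hcoeff : 0 ≤ (1 + α) + c * Λ₃hat := by positivity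
  have hreduce := mul_le_mul_of_nonneg_left hηhat_sq hcoeff
  rw [div_mul_eq_mul_div, div_le_iff₀ (by positivity)]
  linarith
end
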